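/- arXiv:1611.05655 — 3 statements merged into one kernel-verified Lean document; each statement's English description precedes it below -/
import Mathlib

section
/- For all x, y ∈ 𝔽₂^α × R^β, if x·y = 0 in R, then the binary dot product Ψ(x)·Ψ(y) equals 0 in 𝔽₂. -/
/-- The binary field `𝔽₂`. -/
abbrev F2 : Type := ZMod 2

/-- The ring `R = 𝔽₂[u] = 𝔽₂[X]/(X²)` of dual numbers over `𝔽₂`. -/
abbrev Ru : Type := DualNumber F2

/-- Coordinatewise extension `ψ : R^β → 𝔽₂^(2β)` of the Gray-like map
`ψ(0)=(0,0), ψ(1)=(0,1), ψ(u)=(1,1), ψ(1+u)=(1,0)`. -/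
def psiVec {β : ℕ} (x : Fin β → Ru) : Fin (2 * β) → F2 := fun k =>
  if k.val % 2 = 0 then (x ⟨k.val / 2, by have := k.isLt; omega⟩).snd
  else (x ⟨k.val / 2, by have := k.isLt; omega⟩).fst + (x ⟨k.val / 2, by have := k.isLt; omega⟩).snd

/-- The map `Ψ : 𝔽₂^α × R^β → 𝔽₂^(α+2β)`, `Ψ(x | x') = (x | ψ(x'))`. -/
def Psi {α β : ℕ} (p : (Fin α → F2) × (Fin β → Ru)) : Fin (α + 2 * β) → F2 :=
  Fin.append p.1 (psiVec p.2)

/-- The `R`-valued inner product `x·y = u·ι(Σᵢ xᵢyᵢ) + Σⱼ x'ⱼ y'ⱼ ∈ R` on `𝔽₂^α × R^β`,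
where `ι : 𝔽₂ → R` is the inclusion. -/
noncomputable def innR {α β : ℕ} (x y : (Fin α → F2) × (Fin β → Ru)) : Ru :=
  DualNumber.eps * algebraMap F2 Ru (∑ i, x.1 i * y.1 i) + ∑ j, x.2 j * y.2 j

/-- Reindexing a sum over `Fin (2 * n)` as a sum over consecutive pairs of indices. -/
lemma Fin.sum_univ_two_mul {M : Type*} [AddCommMonoid M] {n : ℕ} (f : Fin (2 * n) → M) :
    ∑ k, f k = ∑ j : Fin n, (f ⟨2 * j, by omega⟩ + f ⟨2 * j + 1, by omega⟩) := by
  rw [← (finProdFinEquiv.trans (finCongr (mul_comm n 2))).sum_comp, Fintype.sum_prod_type]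
  refine Finset.sum_congr rfl fun j _ => ?_
  rw [Fin.sum_univ_two]
  congr 2 <;> ext <;> simp [add_comm]

lemma psiVec_two_mul {β : ℕ} (x : Fin β → Ru) (j : Fin β) :
    psiVec x ⟨2 * j, by omega⟩ = (x j).snd := by
  simp [psiVec]

lemma psiVec_two_mul_add_one {β : ℕ} (x : Fin β → Ru) (j : Fin β) :
    psiVec x ⟨2 * j + 1, by omega⟩ = (x j).fst + (x j).snd := by
  have hdiv : (2 * (j : ℕ) + 1) / 2 = j := by omega
  simp [psiVec, hdiv, Nat.add_mod]

lemma sum_psiVec_mul_psiVec {β : ℕ} (x y : Fin β → Ru) :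
    ∑ k, psiVec x k * psiVec y k = (∑ j, x j * y j).fst + (∑ j, x j * y j).snd := by
  rw [Fin.sum_univ_two_mul, TrivSqZeroExt.fst_sum, TrivSqZeroExt.snd_sum,
    ← Finset.sum_add_distrib]
  refine Finset.sum_congr rfl fun j _ => ?_
  rw [psiVec_two_mul, psiVec_two_mul, psiVec_two_mul_add_one, psiVec_two_mul_add_one,
    DualNumber.snd_mul, TrivSqZeroExt.fst_mul]
  linear_combination CharTwo.add_self_eq_zero ((x j).snd * (y j).snd)

/-- The dot product of Gray images is the sum of the two coordinates of the inner product. -/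
lemma sum_Psi_mul_Psi {α β : ℕ} (x y : (Fin α → F2) × (Fin β → Ru)) :
    ∑ i, Psi x i * Psi y i = (innR x y).fst + (innR x y).snd := by
  simp only [Psi, Fin.sum_univ_add, Fin.append_left, Fin.append_right, sum_psiVec_mul_psiVec,
    innR, TrivSqZeroExt.fst_add, TrivSqZeroExt.snd_add, TrivSqZeroExt.fst_mul,
    DualNumber.snd_mul, DualNumber.fst_eps, DualNumber.snd_eps, TrivSqZeroExt.algebraMap_eq_inl,
    TrivSqZeroExt.fst_inl, TrivSqZeroExt.snd_inl]
  ring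

/-- For all `x, y ∈ 𝔽₂^α × R^β`, if `x·y = 0` in `R`, then the binary dot product
`Ψ(x)·Ψ(y)` equals `0` in `𝔽₂`. -/
theorem psi_dotProduct_eq_zero_of_innR_eq_zero (α β : ℕ)
    (x y : (Fin α → F2) × (Fin β → Ru)) (h : innR x y = 0) :
    (∑ i, Psi x i * Psi y i) = 0 := by
  simp [sum_Psi_mul_Psi, h]
end

section
/- Let C ⊆ 𝔽₂^n be an 𝔽₂-linear code. Then Aut(C) has even order if and only if there exist integers α, β with β > 0 and α + 2β = n, a ℤ₂ℤ₂[u]-additive code 𝒞 ⊆ 𝔽₂^α × R^β, and a permutation ρ of the n coordinates such that ρ·C = Ψ(𝒞). -/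
/-- `R` acts on `𝔽₂` through the projection `π : R → 𝔽₂`, `π(u) = 0`. -/
noncomputable instance : Module Ru F2 :=
  Module.compHom F2 (TrivSqZeroExt.fstHom F2 F2 F2).toRingHom

/-- The image of a code under the coordinate permutation `σ`. -/
def permCode {ι F : Type*} (σ : Equiv.Perm ι) (C : Set (ι → F)) : Set (ι → F) :=
  (fun c : ι → F => c ∘ ⇑σ⁻¹) '' C

section PermCode

variable {ι F : Type*}

theorem permCode_mul (σ τ : Equiv.Perm ι) (C : Set (ι → F)) :
    permCode (σ * τ) C = permCode σ (permCode τ C) := by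
  simp only [permCode, Set.image_image, mul_inv_rev]
  rfl

theorem permCode_one (C : Set (ι → F)) : permCode 1 C = C := by
  simp [permCode]

/-- The automorphism group of a code. -/
def codeAut (C : Set (ι → F)) : Subgroup (Equiv.Perm ι) where
  carrier := {σ | permCode σ C = C}
  mul_mem' {σ τ} (hσ : permCode σ C = C) (hτ : permCode τ C = C) := by
    change permCode (σ * τ) C = C
    rw [permCode_mul, hτ, hσ]
  one_mem' := permCode_one C
  inv_mem' {σ} (hσ : permCode σ C = C) := by
    change permCode σ⁻¹ C = C
    conv_lhs => rw [← hσ]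
    rw [← permCode_mul, inv_mul_cancel, permCode_one]

theorem mem_codeAut {C : Set (ι → F)} {σ : Equiv.Perm ι} :
    σ ∈ codeAut C ↔ permCode σ C = C := Iff.rfl

theorem conj_mem_codeAut_permCode {C : Set (ι → F)} {ρ σ : Equiv.Perm ι} :
    ρ * σ * ρ⁻¹ ∈ codeAut (permCode ρ C) ↔ σ ∈ codeAut C := by
  rw [mem_codeAut, mem_codeAut, ← permCode_mul, inv_mul_cancel_right, permCode_mul]
  refine ⟨fun h => ?_, fun h => by rw [h]⟩
  simpa only [← permCode_mul, inv_mul_cancel, permCode_one, inv_mul_cancel_left] using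
    congrArg (permCode ρ⁻¹) h

/-- An involution preserves a code as soon as it maps codewords to codewords. -/
theorem mem_codeAut_of_sq_eq_one {C : Set (ι → F)} {σ : Equiv.Perm ι} (hσ : σ ^ 2 = 1) :
    σ ∈ codeAut C ↔ ∀ c ∈ C, c ∘ σ ∈ C := by
  have hinv : σ⁻¹ = σ := inv_eq_of_mul_eq_one_left (by rw [← sq, hσ])
  rw [mem_codeAut, permCode, hinv]
  refine ⟨fun h c hc => h ▸ Set.mem_image_of_mem _ hc, fun h => Set.Subset.antisymm ?_ ?_⟩
  · rintro _ ⟨c, hc, rfl⟩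
    exact h c hc
  · intro c hc
    refine ⟨c ∘ σ, h c hc, ?_⟩
    funext i
    have hi : σ (σ i) = i := by rw [← Equiv.Perm.mul_apply, ← sq, hσ, Equiv.Perm.one_apply]
    simp [hi]

theorem even_card_codeAut_iff [Finite ι] (C : Set (ι → F)) :
    Even (Nat.card (codeAut C)) ↔ ∃ σ ∈ codeAut C, orderOf σ = 2 := by
  rw [even_iff_two_dvd]
  constructor
  · intro h
    obtain ⟨σ, hσ⟩ := exists_prime_orderOf_dvd_card' 2 h
    exact ⟨σ, σ.2, by rw [Subgroup.orderOf_coe, hσ]⟩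
  · rintro ⟨σ, hσ, h2⟩
    rw [← h2, ← Subgroup.orderOf_mk σ hσ]
    exact orderOf_dvd_natCard _

end PermCode

theorem Equiv.Perm.isConj_of_orderOf_eq_two {ι : Type*} [Fintype ι] [DecidableEq ι]
    {σ τ : Equiv.Perm ι} (hσ : orderOf σ = 2) (hτ : orderOf τ = 2)
    (h : σ.support.card = τ.support.card) : IsConj σ τ := by
  obtain ⟨a, ha⟩ := Equiv.Perm.cycleType_prime_order (hσ ▸ Nat.prime_two)
  obtain ⟨b, hb⟩ := Equiv.Perm.cycleType_prime_order (hτ ▸ Nat.prime_two)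
  rw [← Equiv.Perm.sum_cycleType, ← Equiv.Perm.sum_cycleType, ha, hb, hσ, hτ] at h
  simp only [Multiset.sum_replicate, smul_eq_mul] at h
  rw [Equiv.Perm.isConj_iff_cycleType_eq, ha, hb, hσ, hτ]
  congr 1
  omega

/-- The permutation of `Fin (2 * β)` exchanging `2 * j` and `2 * j + 1` for all `j`. -/
def pairFlip (β : ℕ) : Equiv.Perm (Fin (2 * β)) :=
  Function.Involutive.toPerm
    (fun k => if h : k.val % 2 = 0 then ⟨k.val + 1, by have := k.isLt; omega⟩
      else ⟨k.val - 1, by have := k.isLt; omega⟩)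
    (fun k => by ext; dsimp only; split_ifs <;> grind)

theorem pairFlip_val {β : ℕ} (k : Fin (2 * β)) :
    (pairFlip β k).val = if k.val % 2 = 0 then k.val + 1 else k.val - 1 := by
  change (dite _ _ _ : Fin (2 * β)).val = _
  split_ifs <;> rfl

theorem pairFlip_pairFlip {β : ℕ} (k : Fin (2 * β)) : pairFlip β (pairFlip β k) = k :=
  Function.Involutive.toPerm_involutive _ k

theorem pairFlip_ne {β : ℕ} (k : Fin (2 * β)) : pairFlip β k ≠ k := by
  intro h
  have := congrArg Fin.val h
  rw [pairFlip_val] at this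
  split_ifs at this <;> omega

/-- The permutation of `Fin (α + 2 * β)` fixing the first `α` points and flipping the `β`
consecutive pairs that follow. -/
def tailFlip (α β : ℕ) : Equiv.Perm (Fin (α + 2 * β)) :=
  finSumFinEquiv.permCongr (Equiv.Perm.sumCongr 1 (pairFlip β))

section TailFlip

variable {α β : ℕ}

@[simp]
theorem tailFlip_castAdd (i : Fin α) :
    tailFlip α β (Fin.castAdd (2 * β) i) = Fin.castAdd (2 * β) i := by
  simp [tailFlip, Equiv.permCongr_apply]

@[simp]
theorem tailFlip_natAdd (k : Fin (2 * β)) :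
    tailFlip α β (Fin.natAdd α k) = Fin.natAdd α (pairFlip β k) := by
  simp [tailFlip, Equiv.permCongr_apply]

theorem tailFlip_sq : tailFlip α β ^ 2 = 1 := by
  ext i : 1
  rw [sq, Equiv.Perm.mul_apply, Equiv.Perm.one_apply]
  induction i using Fin.addCases with
  | left i => simp
  | right k => simp [pairFlip_pairFlip]

theorem support_tailFlip :
    (tailFlip α β).support = Finset.univ.map (Fin.natAddEmb α) := by
  ext i
  induction i using Fin.addCases with
  | left i =>
    simp only [Equiv.Perm.mem_support, tailFlip_castAdd, ne_eq, not_true, Finset.mem_map,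
      Finset.mem_univ, true_and, false_iff, not_exists, Fin.natAddEmb_apply]
    intro k h
    have := congrArg Fin.val h
    simp at this
    omega
  | right k => simp [pairFlip_ne]

theorem card_support_tailFlip : (tailFlip α β).support.card = 2 * β := by
  simp [support_tailFlip]

theorem orderOf_tailFlip (hβ : 0 < β) : orderOf (tailFlip α β) = 2 := by
  refine orderOf_eq_prime tailFlip_sq fun h => ?_
  have := card_support_tailFlip (α := α) (β := β)
  rw [h, Equiv.Perm.support_one, Finset.card_empty] at this
  omega

end TailFlip

section Gray

variable {α β : ℕ}

theorem psiVec_add (x y : Fin β → Ru) : psiVec (x + y) = psiVec x + psiVec y := by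
  funext k
  simp only [psiVec, Pi.add_apply, TrivSqZeroExt.fst_add, TrivSqZeroExt.snd_add]
  split_ifs <;> ring

theorem Psi_add (p q : (Fin α → F2) × (Fin β → Ru)) : Psi (p + q) = Psi p + Psi q := by
  funext i
  induction i using Fin.addCases with
  | left i => simp [Psi]
  | right k => simp [Psi, psiVec_add]

theorem Ru_smul_F2 (r : Ru) (a : F2) : r • a = r.fst * a := rfl

/-- Scalar multiplication on words, read through the Gray map. -/
theorem Psi_smul (r : Ru) (p : (Fin α → F2) × (Fin β → Ru)) :
    Psi (r • p) = r.fst • Psi p + r.snd • (Psi p + Psi p ∘ tailFlip α β) := by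
  funext i
  induction i using Fin.addCases with
  | left i => simp [Psi, Ru_smul_F2, CharTwo.add_self_eq_zero]
  | right k =>
    have hdiv : (pairFlip β k).val / 2 = k.val / 2 := by
      rw [pairFlip_val]; split_ifs <;> omega
    have hmod : (pairFlip β k).val % 2 = 0 ↔ ¬ k.val % 2 = 0 := by
      rw [pairFlip_val]; split_ifs <;> omega
    have hsmul (j : Fin β) : (r • p).2 j = r * p.2 j := rfl
    simp only [Psi, psiVec, hsmul, Pi.add_apply, Pi.smul_apply, Function.comp_apply,
      tailFlip_natAdd, Fin.append_right, hdiv, hmod, smul_eq_mul, TrivSqZeroExt.fst_mul,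
      TrivSqZeroExt.snd_mul, MulOpposite.smul_eq_mul_unop, MulOpposite.unop_op]
    generalize p.2 _ = x
    generalize x.fst = a, x.snd = b, r.fst = c, r.snd = d
    split_ifs <;> revert a b c d <;> decide

theorem Psi_comp_tailFlip (p : (Fin α → F2) × (Fin β → Ru)) :
    Psi p ∘ tailFlip α β = Psi ((1 + DualNumber.eps : Ru) • p) := by
  have hself : Psi p + Psi p = 0 := funext fun i => CharTwo.add_self_eq_zero _
  rw [Psi_smul]
  simp [← add_assoc, hself]

theorem Psi_surjective : Function.Surjective (Psi (α := α) (β := β)) := by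
  intro w
  refine ⟨(fun i => w (Fin.castAdd _ i), fun j =>
    TrivSqZeroExt.inl (w (Fin.natAdd α ⟨2 * j, by omega⟩) + w (Fin.natAdd α ⟨2 * j + 1, by omega⟩))
      + TrivSqZeroExt.inr (w (Fin.natAdd α ⟨2 * j, by omega⟩))), ?_⟩
  funext i
  induction i using Fin.addCases with
  | left i => simp [Psi]
  | right k =>
    simp only [Psi, psiVec, Fin.append_right]
    split_ifs with hk
    · simp only [TrivSqZeroExt.snd_add, TrivSqZeroExt.snd_inl, TrivSqZeroExt.snd_inr, zero_add]
      congr 2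
      ext
      dsimp only
      omega
    · simp only [TrivSqZeroExt.snd_add, TrivSqZeroExt.snd_inl, TrivSqZeroExt.snd_inr, zero_add,
        TrivSqZeroExt.fst_add, TrivSqZeroExt.fst_inl, TrivSqZeroExt.fst_inr, add_zero]
      rw [add_right_comm, CharTwo.add_self_eq_zero, zero_add]
      congr 2
      ext
      dsimp only
      omega

/-- The linear codes that are Gray images of `ℤ₂ℤ₂[u]`-additive codes are exactly those
invariant under `tailFlip α β`. -/
theorem exists_image_Psi_iff (D : Submodule F2 (Fin (α + 2 * β) → F2)) :
    (∃ 𝒞 : Submodule Ru ((Fin α → F2) × (Fin β → Ru)),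
      (D : Set (Fin (α + 2 * β) → F2)) = Psi '' (𝒞 : Set ((Fin α → F2) × (Fin β → Ru)))) ↔
    tailFlip α β ∈ codeAut (D : Set (Fin (α + 2 * β) → F2)) := by
  rw [mem_codeAut_of_sq_eq_one tailFlip_sq]
  constructor
  · rintro ⟨𝒞, h⟩
    rw [h]
    rintro _ ⟨p, hp, rfl⟩
    exact ⟨_, 𝒞.smul_mem _ hp, (Psi_comp_tailFlip p).symm⟩
  · intro h
    refine ⟨{ carrier := {p | Psi p ∈ D}, add_mem' := ?_, zero_mem' := ?_, smul_mem' := ?_ },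
      (Set.image_preimage_eq _ Psi_surjective).symm⟩
    · intro p q hp hq
      simpa only [Set.mem_ofPred_eq, Psi_add] using D.add_mem hp hq
    · have : Psi (0 : (Fin α → F2) × (Fin β → Ru)) = 0 := by
        simpa using Psi_add (0 : (Fin α → F2) × (Fin β → Ru)) 0
      simpa only [Set.mem_ofPred_eq, this] using D.zero_mem
    · intro r p hp
      simpa only [Set.mem_ofPred_eq, Psi_smul] using
        D.add_mem (D.smul_mem _ hp) (D.smul_mem _ (D.add_mem hp (h _ hp)))

end Gray

/-- The image of a linear code under a coordinate permutation, as a linear code. -/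
theorem coe_map_funLeft {ι F : Type*} [Semiring F] (ρ : Equiv.Perm ι) (C : Submodule F (ι → F)) :
    (C.map (LinearMap.funLeft F F ⇑ρ⁻¹) : Set (ι → F)) = permCode ρ (C : Set (ι → F)) := rfl

/-- Let `C ⊆ 𝔽₂^n` be an `𝔽₂`-linear code. Then `Aut(C)` has even order if and only if
there exist `α, β` with `β > 0` and `n = α + 2β`, a `ℤ₂ℤ₂[u]`-additive code
`𝒞 ⊆ 𝔽₂^α × R^β`, and a permutation `ρ` of the `n` coordinates such that
`ρ·C = Ψ(𝒞)` (up to the canonical identification of `𝔽₂^n` with `𝔽₂^(α+2β)`). -/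
theorem aut_even_iff_z2z2u_linear (n : ℕ) (C : Submodule F2 (Fin n → F2)) :
    Even (Nat.card {σ : Equiv.Perm (Fin n) //
        (fun c : Fin n → F2 => c ∘ ⇑σ⁻¹) '' (C : Set (Fin n → F2)) = C}) ↔
    ∃ (α β : ℕ) (h : n = α + 2 * β), 0 < β ∧
      ∃ (𝒞 : Submodule Ru ((Fin α → F2) × (Fin β → Ru))) (ρ : Equiv.Perm (Fin n)),
        (fun c : Fin n → F2 => c ∘ ⇑ρ⁻¹) '' (C : Set (Fin n → F2)) =
          (fun p => Psi p ∘ Fin.cast h) '' (𝒞 : Set ((Fin α → F2) × (Fin β → Ru))) := by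
  change Even (Nat.card (codeAut (C : Set (Fin n → F2)))) ↔ _
  rw [even_card_codeAut_iff]
  constructor
  · rintro ⟨σ, hσ, h2⟩
    obtain ⟨b, hb⟩ := Equiv.Perm.cycleType_prime_order (h2 ▸ Nat.prime_two)
    have hcard : σ.support.card = 2 * (b + 1) := by
      rw [← Equiv.Perm.sum_cycleType, hb, h2, Multiset.sum_replicate, smul_eq_mul, mul_comm]
    obtain ⟨α, h⟩ : ∃ α, n = α + 2 * (b + 1) := by
      have : σ.support.card ≤ n := σ.support.card_le_univ.trans_eq (Fintype.card_fin n)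
      exact ⟨n - 2 * (b + 1), by omega⟩
    subst h
    obtain ⟨ρ, hρ⟩ := isConj_iff.mp (Equiv.Perm.isConj_of_orderOf_eq_two h2
      (orderOf_tailFlip (α := α) b.succ_pos) (hcard.trans card_support_tailFlip.symm))
    rw [← conj_mem_codeAut_permCode (ρ := ρ), hρ, ← coe_map_funLeft, ← exists_image_Psi_iff] at hσ
    obtain ⟨𝒞, h𝒞⟩ := hσ
    exact ⟨α, b + 1, rfl, b.succ_pos, 𝒞, ρ, h𝒞⟩
  · rintro ⟨α, β, rfl, hβ, 𝒞, ρ, h⟩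
    refine ⟨ρ⁻¹ * tailFlip α β * ρ, ?_, ?_⟩
    · rw [← conj_mem_codeAut_permCode (ρ := ρ), ← coe_map_funLeft]
      convert (exists_image_Psi_iff (C.map (LinearMap.funLeft F2 F2 ⇑ρ⁻¹))).mp ⟨𝒞, h⟩ using 1
      group
    · refine Eq.trans ?_ (orderOf_tailFlip (α := α) hβ)
      simpa using (MulAut.conj ρ⁻¹).orderOf_eq (tailFlip α β)
end

section
/- Let 𝒞 ⊆ ℤ₄³ be the additive subgroup generated by (1,1,1) and (0,2,3). Then: (a) the binary image Φ(𝒞) is an 𝔽₂-linear subspace of 𝔽₂⁶; (b) the vector (1,1,2) satisfies (1,1,2)·c = 0 in ℤ₄ for every c ∈ 𝒞, where the inner product is the standard one on ℤ₄³ (sum of coordinatewise products); and (c) Φ(1,1,2) = (0,1,0,1,1,1) is not orthogonal to every element of Φ(𝒞) under the binary dot product, i.e., Φ(1,1,2) ∉ Φ(𝒞)^⊥. -/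
/-- The ring `ℤ₄`. -/
abbrev Z4 : Type := ZMod 4

/-- The Gray map `φ : ℤ₄ → 𝔽₂²`, `φ(0)=(0,0), φ(1)=(0,1), φ(2)=(1,1), φ(3)=(1,0)`. -/
def phi4 (a : Z4) : F2 × F2 :=
  match a.val with
  | 0 => (0, 0)
  | 1 => (0, 1)
  | 2 => (1, 1)
  | _ => (1, 0)

/-- Coordinatewise extension `φ : ℤ₄^β → 𝔽₂^(2β)` of the Gray map. -/
def phiVec {β : ℕ} (x : Fin β → Z4) : Fin (2 * β) → F2 := fun k =>
  if k.val % 2 = 0 then (phi4 (x ⟨k.val / 2, by have := k.isLt; omega⟩)).1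
  else (phi4 (x ⟨k.val / 2, by have := k.isLt; omega⟩)).2

/-- The quaternary code `𝒞 ⊆ ℤ₄³` generated (as an additive subgroup) by `(1,1,1)` and
`(0,2,3)`. -/
noncomputable def Ccode : AddSubgroup (Fin 3 → Z4) :=
  AddSubgroup.closure {![1, 1, 1], ![0, 2, 3]}

theorem phi4_add (a b : Z4) : phi4 a + phi4 b = phi4 (a + b + 2 * (a * b)) := by
  revert a b; decide

theorem phiVec_add {β : ℕ} (x y : Fin β → Z4) :
    phiVec x + phiVec y = phiVec (x + y + 2 * (x * y)) := by
  funext k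
  simp only [phiVec, Pi.add_apply, Pi.mul_apply, Pi.ofNat_apply, ← phi4_add]
  split_ifs <;> rfl

theorem phiVec_zero {β : ℕ} : phiVec (0 : Fin β → Z4) = 0 := by
  funext k
  simp only [phiVec, Pi.zero_apply]
  split_ifs <;> rfl

/-- The code `𝒞` is cut out by the single parity check `(1,1,2)`. -/
theorem mem_Ccode_iff (c : Fin 3 → Z4) : c ∈ Ccode ↔ c 0 + c 1 + 2 * c 2 = 0 := by
  rw [Ccode, AddSubgroup.mem_closure_pair]
  constructor
  · rintro ⟨m, n, rfl⟩
    have h : (4 : Z4) = 0 := rfl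
    simp only [zsmul_eq_mul, Pi.add_apply, Pi.mul_apply, Pi.intCast_apply, Matrix.cons_val]
    linear_combination (m + 2 * n : Z4) * h
  · intro h
    refine ⟨(c 0).val, (c 0 - c 2).val, ?_⟩
    have key : ∀ x y z : Z4, x + y + 2 * z = 0 →
        x + (x - z) * 2 = y ∧ x + (x - z) * 3 = z := by decide
    obtain ⟨h₁, h₂⟩ := key _ _ _ h
    funext i
    fin_cases i <;> simp [h₁, h₂]

theorem gray_sum_mem_Ccode {x y : Fin 3 → Z4} (hx : x ∈ Ccode) (hy : y ∈ Ccode) :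
    x + y + 2 * (x * y) ∈ Ccode := by
  rw [mem_Ccode_iff] at *
  simp only [Pi.add_apply, Pi.mul_apply, Pi.ofNat_apply]
  have h : (4 : Z4) = 0 := rfl
  have key : ∀ a b c d : Z4, a + b + 2 * c = 0 → ∀ e f : Z4, d + e + 2 * f = 0 →
      2 * (a * d) + 2 * (b * e) = 0 := by decide
  linear_combination hx + hy + key _ _ _ _ hx _ _ hy + x 2 * y 2 * h

/-- (a) The binary image `Φ(𝒞)` is an `𝔽₂`-linear subspace of `𝔽₂⁶`; (b) `(1,1,2)` is
orthogonal to every codeword of `𝒞` for the standard inner product on `ℤ₄³`; and (c)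
`Φ(1,1,2) = (0,1,0,1,1,1)` is not orthogonal to every element of `Φ(𝒞)` under the binary
dot product, i.e. `Φ(1,1,2) ∉ Φ(𝒞)^⊥`. -/
theorem z4_example_dual_not_binary_dual :
    (∃ C : Submodule F2 (Fin (2 * 3) → F2),
      (C : Set (Fin (2 * 3) → F2)) = phiVec '' (Ccode : Set (Fin 3 → Z4))) ∧
    (∀ c ∈ Ccode, (∑ j, (![1, 1, 2] : Fin 3 → Z4) j * c j) = 0) ∧
    phiVec (![1, 1, 2] : Fin 3 → Z4) = (![0, 1, 0, 1, 1, 1] : Fin 6 → F2) ∧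
    ¬ (∀ c ∈ phiVec '' (Ccode : Set (Fin 3 → Z4)),
        (∑ i, phiVec (![1, 1, 2] : Fin 3 → Z4) i * c i) = 0) := by
  refine ⟨⟨{ carrier := phiVec '' (Ccode : Set (Fin 3 → Z4))
             zero_mem' := ⟨0, zero_mem _, phiVec_zero⟩
             add_mem' := ?_
             smul_mem' := ?_ }, rfl⟩, ?_, ?_, ?_⟩
  · rintro _ _ ⟨x, hx, rfl⟩ ⟨y, hy, rfl⟩
    exact ⟨_, gray_sum_mem_Ccode hx hy, (phiVec_add x y).symm⟩
  · rintro r _ ⟨x, hx, rfl⟩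
    obtain rfl | rfl : r = 0 ∨ r = 1 := by revert r; decide
    · exact ⟨0, zero_mem _, by rw [zero_smul, phiVec_zero]⟩
    · exact ⟨x, hx, by rw [one_smul]⟩
  · intro c hc
    simpa [Fin.sum_univ_three] using (mem_Ccode_iff c).1 hc
  · decide
  · intro h
    have h₁ := h _ ⟨![1, 1, 1], (mem_Ccode_iff _).2 (by decide), rfl⟩
    revert h₁
    decide
end
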